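/- arXiv:1008.5167 — 6 statements merged into one kernel-verified Lean document; each statement's English description precedes it below -/
import Mathlib

section
/- Let E be a real inner product space, K ∈ ℝ, and let Y be twice differentiable on an open interval around a point s, with Y(s) ≠ 0 and ⟨Y(s), Y''(s)⟩ ≥ −K·‖Y(s)‖². Then the function φ(u) := ‖Y(u)‖ is twice differentiable at s and satisfies the differential inequality φ''(s) + K·φ(s) ≥ 0. -/
open scoped RealInnerProductSpace

theorem HasDerivAt.norm_of_ne_zero {E : Type*} [NormedAddCommGroup E] [InnerProductSpace ℝ E]
    {Y : ℝ → E} {Y' : E} {u : ℝ} (hY : HasDerivAt Y Y' u) (hne : Y u ≠ 0) :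
    HasDerivAt (fun v => ‖Y v‖) (⟪Y u, Y'⟫ / ‖Y u‖) u := by
  have h := hY.norm_sq.sqrt (pow_ne_zero 2 (norm_ne_zero_iff.mpr hne))
  simp only [Real.sqrt_sq (norm_nonneg _)] at h
  rwa [mul_div_mul_left _ _ two_ne_zero] at h

theorem hasDerivAt_deriv_norm {E : Type*} [NormedAddCommGroup E] [InnerProductSpace ℝ E]
    {Y : ℝ → E} {Y'' : E} {s : ℝ} (hY : ∀ᶠ u in nhds s, DifferentiableAt ℝ Y u)
    (hY' : HasDerivAt (deriv Y) Y'' s) (hne : Y s ≠ 0) :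
    HasDerivAt (deriv fun u => ‖Y u‖)
      (⟪Y s, Y''⟫ / ‖Y s‖ +
        (‖Y s‖ ^ 2 * ‖deriv Y s‖ ^ 2 - ⟪Y s, deriv Y s⟫ ^ 2) / ‖Y s‖ ^ 3) s := by
  have hYs := hY.self_of_nhds.hasDerivAt
  have hn : ‖Y s‖ ≠ 0 := norm_ne_zero_iff.mpr hne
  have hderiv : (deriv fun u => ‖Y u‖) =ᶠ[nhds s] fun u => ⟪Y u, deriv Y u⟫ / ‖Y u‖ := by
    filter_upwards [hY, hYs.continuousAt.eventually_ne hne] with u hu hu0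
    exact (hu.hasDerivAt.norm_of_ne_zero hu0).deriv
  refine HasDerivAt.congr_of_eventuallyEq ?_ hderiv
  refine ((hYs.inner ℝ hY').fun_div (hYs.norm_of_ne_zero hne) hn).congr_deriv ?_
  rw [real_inner_self_eq_norm_sq]
  field_simp
  ring

theorem norm_jacobi_second_deriv_ineq {E : Type*} [NormedAddCommGroup E]
    [InnerProductSpace ℝ E] (K s ε : ℝ) (hε : 0 < ε) (Y : ℝ → E)
    (hY : ∀ u ∈ Set.Ioo (s - ε) (s + ε), DifferentiableAt ℝ Y u)
    (hY' : ∀ u ∈ Set.Ioo (s - ε) (s + ε), DifferentiableAt ℝ (deriv Y) u)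
    (hne : Y s ≠ 0)
    (hJacobi : ⟪Y s, deriv (deriv Y) s⟫ ≥ -K * ‖Y s‖ ^ 2) :
    DifferentiableAt ℝ (fun u => ‖Y u‖) s ∧
    DifferentiableAt ℝ (deriv fun u => ‖Y u‖) s ∧
    deriv (deriv fun u => ‖Y u‖) s + K * ‖Y s‖ ≥ 0 := by
  have hs : s ∈ Set.Ioo (s - ε) (s + ε) := ⟨by linarith, by linarith⟩
  have hnhds : ∀ᶠ u in nhds s, DifferentiableAt ℝ Y u :=
    Filter.mem_of_superset (isOpen_Ioo.mem_nhds hs) hY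
  have hsecond := hasDerivAt_deriv_norm hnhds (hY' s hs).hasDerivAt hne
  have hn : 0 < ‖Y s‖ := norm_pos_iff.mpr hne
  refine ⟨((hY s hs).hasDerivAt.norm_of_ne_zero hne).differentiableAt,
    hsecond.differentiableAt, ?_⟩
  rw [hsecond.deriv]
  have hcurv : -K * ‖Y s‖ ≤ ⟪Y s, deriv (deriv Y) s⟫ / ‖Y s‖ := by
    rw [le_div_iff₀ hn]
    linarith
  have hcauchy : ⟪Y s, deriv Y s⟫ ^ 2 ≤ ‖Y s‖ ^ 2 * ‖deriv Y s‖ ^ 2 := by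
    rw [← mul_pow]
    exact sq_le_sq.mpr ((abs_real_inner_le_norm _ _).trans (le_abs_self _))
  have hrem : 0 ≤ (‖Y s‖ ^ 2 * ‖deriv Y s‖ ^ 2 - ⟪Y s, deriv Y s⟫ ^ 2) / ‖Y s‖ ^ 3 :=
    div_nonneg (sub_nonneg.mpr hcauchy) (by positivity)
  linarith
end

section
/- Let E be a real inner product space, K ∈ ℝ, and T > 0, with T ≤ π·K^{-1/2} in the case K > 0. Let Y : [0,T] → E be twice continuously differentiable with Y(0) = 0, Y'(0) ≠ 0, and ⟨Y(s), Y''(s)⟩ ≥ −K·‖Y(s)‖² for all s ∈ [0,T]. Then ‖Y(s)‖ ≥ ‖Y'(0)‖·Φ_K(s) for all s ∈ [0,T]; in particular, Y(s) ≠ 0 for all s ∈ (0,T). -/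
open scoped RealInnerProductSpace

/-- The comparison function `Φ_K`. -/
noncomputable def PhiComp (K t : ℝ) : ℝ :=
  if K < 0 then Real.sinh (Real.sqrt |K| * t) / Real.sqrt |K|
  else if K = 0 then t
  else Real.sin (Real.sqrt K * t) / Real.sqrt K

open Filter Topology Set

/-- A function with nonnegative derivative on `(0, T)` is bounded below by its limit at `0⁺`. -/
lemma le_of_tendsto_of_hasDerivAt_nonneg {f f' : ℝ → ℝ} {T l : ℝ}
    (hf : ∀ t ∈ Ioo 0 T, HasDerivAt f (f' t) t) (hf' : ∀ t ∈ Ioo 0 T, 0 ≤ f' t)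
    (hl : Tendsto f (𝓝[>] 0) (𝓝 l)) {s : ℝ} (hs : s ∈ Ioo 0 T) : l ≤ f s := by
  have hmono : MonotoneOn f (Ioo 0 T) := by
    refine monotoneOn_of_deriv_nonneg (convex_Ioo 0 T)
      (fun t ht => (hf t ht).continuousAt.continuousWithinAt) ?_ ?_
    · rw [interior_Ioo]
      exact fun t ht => (hf t ht).differentiableAt.differentiableWithinAt
    · rw [interior_Ioo]
      intro t ht
      rw [(hf t ht).deriv]
      exact hf' t ht
  refine le_of_tendsto hl ?_
  filter_upwards [Ioo_mem_nhdsGT hs.1] with t ht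
  exact hmono ⟨ht.1, ht.2.trans hs.2⟩ hs ht.2.le

/-- A right derivative at a zero is the limit of the quotients `t⁻¹ • f t`. -/
lemma tendsto_inv_smul_of_hasDerivWithinAt {E : Type*} [NormedAddCommGroup E] [NormedSpace ℝ E]
    {f : ℝ → E} {f' : E} (hf : HasDerivWithinAt f f' (Ioi 0) 0) (h0 : f 0 = 0) :
    Tendsto (fun t => t⁻¹ • f t) (𝓝[>] 0) (𝓝 f') := by
  have h := (hasDerivWithinAt_iff_tendsto_slope' (by simp)).1 hf
  refine h.congr fun t => ?_
  simp [slope, h0]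

/-- Comparison of a vector-valued solution of `⟪Y, Y''⟫ ≥ -K ‖Y‖²` with a positive scalar solution
of `φ'' = -K φ`, `φ 0 = 0`, `φ' 0 = 1`. -/
lemma norm_ge_mul_of_inner_ge {E : Type*} [NormedAddCommGroup E] [InnerProductSpace ℝ E]
    {K T : ℝ} {Y Y' Y'' : ℝ → E} {φ φ' : ℝ → ℝ}
    (hφ : ∀ t, HasDerivAt φ (φ' t) t) (hφ' : ∀ t, HasDerivAt φ' (-K * φ t) t)
    (hφ0 : φ 0 = 0) (hφ'0 : φ' 0 = 1) (hpos : ∀ t ∈ Ioo 0 T, 0 < φ t)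
    (hY : ∀ t ∈ Ioo 0 T, HasDerivAt Y (Y' t) t) (hY' : ∀ t ∈ Ioo 0 T, HasDerivAt Y' (Y'' t) t)
    (hYd0 : HasDerivWithinAt Y (Y' 0) (Ioi 0) 0) (hY'0 : ContinuousWithinAt Y' (Ioi 0) 0)
    (hY0 : Y 0 = 0) (hJ : ∀ t ∈ Ioo 0 T, -K * ‖Y t‖ ^ 2 ≤ ⟪Y t, Y'' t⟫)
    {s : ℝ} (hs : s ∈ Ioo 0 T) : ‖Y' 0‖ * φ s ≤ ‖Y s‖ := by
  have hYq := tendsto_inv_smul_of_hasDerivWithinAt hYd0 hY0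
  have hφq : Tendsto (fun t => t⁻¹ * φ t) (𝓝[>] 0) (𝓝 1) := by
    have := tendsto_inv_smul_of_hasDerivWithinAt (hφ 0).hasDerivWithinAt hφ0
    rwa [hφ'0] at this
  have hYc : Tendsto Y (𝓝[>] 0) (𝓝 0) := by
    have := hYd0.continuousWithinAt.tendsto
    rwa [hY0] at this
  have hφ'c : Tendsto φ' (𝓝[>] 0) (𝓝 1) := by
    have := (hφ' 0).continuousAt.continuousWithinAt (s := Ioi 0) |>.tendsto
    rwa [hφ'0] at this
  -- This quantity is the inner product of `u` and `φ² • deriv u` for `u = Y / φ`.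
  have hP : ∀ t ∈ Ioo 0 T, 0 ≤ ⟪Y t, Y' t⟫ - ⟪Y t, Y t⟫ * φ' t / φ t := by
    intro t ht
    refine le_of_tendsto_of_hasDerivAt_nonneg
      (f := fun t => ⟪Y t, Y' t⟫ - ⟪Y t, Y t⟫ * φ' t / φ t)
      (fun t ht => (((hY t ht).inner ℝ (hY' t ht)).sub
        ((((hY t ht).inner ℝ (hY t ht)).mul (hφ' t)).div (hφ t) (hpos t ht).ne'))) ?_ ?_ ht
    · intro t ht
      have hp := hpos t ht
      have hsq : 0 ≤ ⟪Y' t - (φ' t / φ t) • Y t, Y' t - (φ' t / φ t) • Y t⟫ :=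
        real_inner_self_nonneg
      have hj := hJ t ht
      rw [← real_inner_self_eq_norm_sq] at hj
      simp only [inner_sub_left, inner_sub_right, real_inner_smul_left, real_inner_smul_right,
        real_inner_comm (Y t) (Y' t), Pi.mul_apply] at hsq ⊢
      refine (add_nonneg hsq (sub_nonneg.2 hj)).trans_eq ?_
      field_simp
      ring
    · have h := (hYc.inner (𝕜 := ℝ) hY'0.tendsto).sub
        (((hYq.inner (𝕜 := ℝ) hYc).mul hφ'c).div hφq one_ne_zero)
      simp only [inner_zero_left, inner_zero_right, zero_mul, zero_div, sub_zero] at h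
      refine h.congr' ?_
      filter_upwards [Ioo_mem_nhdsGT (hs.1.trans hs.2)] with t ht
      have hp := hpos t ht
      have ht0 := ht.1
      simp only [Pi.div_apply, real_inner_smul_left]
      field_simp
  have hQ : ‖Y' 0‖ ^ 2 ≤ ⟪Y s, Y s⟫ / φ s ^ 2 := by
    refine le_of_tendsto_of_hasDerivAt_nonneg (f := fun t => ⟪Y t, Y t⟫ / φ t ^ 2)
      (fun t ht => ((hY t ht).inner ℝ (hY t ht)).div ((hφ t).pow 2)
        (pow_ne_zero 2 (hpos t ht).ne')) ?_ ?_ hs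
    · intro t ht
      have hp := hpos t ht
      refine (mul_nonneg (hP t ht) (show 0 ≤ 2 / φ t ^ 2 by positivity)).trans_eq ?_
      rw [real_inner_comm (Y t) (Y' t)]
      simp only [Pi.pow_apply]
      field_simp
      ring
    · have h := (hYq.inner (𝕜 := ℝ) hYq).div (hφq.pow 2) (by norm_num)
      rw [one_pow, div_one, real_inner_self_eq_norm_sq] at h
      refine h.congr' ?_
      filter_upwards [Ioo_mem_nhdsGT (hs.1.trans hs.2)] with t ht
      have hp := hpos t ht
      have ht0 := ht.1
      simp only [Pi.div_apply, real_inner_smul_left, real_inner_smul_right]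
      field_simp
  have hp := hpos s hs
  rw [le_div_iff₀ (by positivity), real_inner_self_eq_norm_sq, ← mul_pow] at hQ
  exact le_of_sq_le_sq hQ (norm_nonneg _)

/-- `PhiComp K` solves `φ'' = -K φ` with `φ 0 = 0` and `φ' 0 = 1`. -/
lemma exists_deriv_PhiComp (K : ℝ) : ∃ φ' : ℝ → ℝ,
    (∀ t, HasDerivAt (PhiComp K) (φ' t) t) ∧ (∀ t, HasDerivAt φ' (-K * PhiComp K t) t) ∧
    φ' 0 = 1 := by
  rcases lt_trichotomy K 0 with hK | hK | hK
  · have hr : 0 < √|K| := Real.sqrt_pos.2 (abs_pos.2 hK.ne)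
    have hr2 : √|K| ^ 2 = -K := by rw [Real.sq_sqrt (abs_nonneg K), abs_of_neg hK]
    have hΦ : PhiComp K = fun t => Real.sinh (√|K| * t) / √|K| := by
      funext t
      simp [PhiComp, hK]
    have hlin (t : ℝ) : HasDerivAt (fun t => √|K| * t) √|K| t := by
      simpa using (hasDerivAt_id t).const_mul √|K|
    refine ⟨fun t => Real.cosh (√|K| * t), fun t => ?_, fun t => ?_, by simp⟩
    · rw [hΦ]
      refine ((hlin t).sinh.div_const _).congr_deriv ?_
      field_simp
    · rw [hΦ, ← hr2]
      refine (hlin t).cosh.congr_deriv ?_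
      field_simp
  · have hΦ : PhiComp K = fun t => t := by
      funext t
      simp [PhiComp, hK]
    refine ⟨fun _ => 1, fun t => ?_, fun t => ?_, rfl⟩
    · rw [hΦ]
      exact hasDerivAt_id t
    · simpa [hK] using hasDerivAt_const t (1 : ℝ)
  · have hr : 0 < √K := Real.sqrt_pos.2 hK
    have hr2 : √K ^ 2 = K := Real.sq_sqrt hK.le
    have hΦ : PhiComp K = fun t => Real.sin (√K * t) / √K := by
      funext t
      simp [PhiComp, hK.le, hK.ne']
    have hlin (t : ℝ) : HasDerivAt (fun t => √K * t) √K t := by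
      simpa using (hasDerivAt_id t).const_mul √K
    refine ⟨fun t => Real.cos (√K * t), fun t => ?_, fun t => ?_, by simp⟩
    · rw [hΦ]
      refine ((hlin t).sin.div_const _).congr_deriv ?_
      field_simp
    · rw [hΦ]
      refine (hlin t).cos.congr_deriv ?_
      field_simp
      rw [hr2]
      ring

lemma PhiComp_zero (K : ℝ) : PhiComp K 0 = 0 := by
  simp [PhiComp]

lemma PhiComp_pos {K T t : ℝ} (hTK : 0 < K → T ≤ Real.pi / √K) (ht : t ∈ Ioo 0 T) :
    0 < PhiComp K t := by
  unfold PhiComp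
  have ht0 := ht.1
  split_ifs with h1 h2
  · have hr : 0 < √|K| := Real.sqrt_pos.2 (abs_pos.2 h1.ne)
    exact div_pos (Real.sinh_pos_iff.2 (by positivity)) hr
  · exact ht0
  · have hK : 0 < K := lt_of_le_of_ne (not_lt.1 h1) (Ne.symm h2)
    have hr : 0 < √K := Real.sqrt_pos.2 hK
    refine div_pos (Real.sin_pos_of_pos_of_lt_pi (by positivity) ?_) hr
    rw [mul_comm, ← lt_div_iff₀ hr]
    exact ht.2.trans_le (hTK hK)

theorem jacobi_field_estimate {E : Type*} [NormedAddCommGroup E] [InnerProductSpace ℝ E]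
    (K T : ℝ) (hT : 0 < T) (hTK : 0 < K → T ≤ Real.pi / Real.sqrt K) (Y : ℝ → E)
    (hY : ContDiffOn ℝ 2 Y (Set.Icc 0 T))
    (h0 : Y 0 = 0) (h0' : derivWithin Y (Set.Icc 0 T) 0 ≠ 0)
    (hJacobi : ∀ s ∈ Set.Icc 0 T,
      ⟪Y s, derivWithin (derivWithin Y (Set.Icc 0 T)) (Set.Icc 0 T) s⟫ ≥ -K * ‖Y s‖ ^ 2) :
    (∀ s ∈ Set.Icc 0 T, ‖Y s‖ ≥ ‖derivWithin Y (Set.Icc 0 T) 0‖ * PhiComp K s) ∧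
    (∀ s ∈ Set.Ioo 0 T, Y s ≠ 0) := by
  obtain ⟨φ', hφ, hφ', hφ'0⟩ := exists_deriv_PhiComp K
  have hYd : DifferentiableOn ℝ Y (Icc 0 T) := hY.differentiableOn (by norm_num)
  have hY1 : ContDiffOn ℝ 1 (derivWithin Y (Icc 0 T)) (Icc 0 T) :=
    hY.derivWithin (uniqueDiffOn_Icc hT) (by norm_num)
  have hY'd : DifferentiableOn ℝ (derivWithin Y (Icc 0 T)) (Icc 0 T) :=
    hY1.differentiableOn (by norm_num)
  have hmem : (0 : ℝ) ∈ Icc 0 T := left_mem_Icc.2 hT.le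
  have hright : Icc 0 T ∈ 𝓝[>] (0 : ℝ) := Icc_mem_nhdsGT hT
  have hint : ∀ s ∈ Ioo 0 T, ‖derivWithin Y (Icc 0 T) 0‖ * PhiComp K s ≤ ‖Y s‖ := by
    intro s hs
    exact norm_ge_mul_of_inner_ge (Y' := derivWithin Y (Icc 0 T))
      (Y'' := derivWithin (derivWithin Y (Icc 0 T)) (Icc 0 T)) hφ hφ' (PhiComp_zero K) hφ'0
      (fun t ht => PhiComp_pos hTK ht)
      (fun t ht => (hYd t (Ioo_subset_Icc_self ht)).hasDerivWithinAt.hasDerivAt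
        (Icc_mem_nhds ht.1 ht.2))
      (fun t ht => (hY'd t (Ioo_subset_Icc_self ht)).hasDerivWithinAt.hasDerivAt
        (Icc_mem_nhds ht.1 ht.2))
      ((hYd 0 hmem).hasDerivWithinAt.mono_of_mem_nhdsWithin hright)
      ((hY'd 0 hmem).continuousWithinAt.mono_of_mem_nhdsWithin hright)
      h0 (fun t ht => hJacobi t (Ioo_subset_Icc_self ht)) hs
  refine ⟨fun s hs => ?_, fun s hs hYs => ?_⟩
  · have hclos : closure (Ioo 0 T) = Icc 0 T := closure_Ioo hT.ne
    refine ContinuousWithinAt.closure_le (s := Ioo 0 T) (hclos ▸ hs) ?_ ?_ hint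
    · exact (continuousAt_const.mul (hφ s).continuousAt).continuousWithinAt
    · exact ((hYd s hs).continuousWithinAt.mono Ioo_subset_Icc_self).norm
  · have h := hint s hs
    rw [hYs, norm_zero] at h
    exact absurd h (not_le.2 (mul_pos (norm_pos_iff.2 h0') (PhiComp_pos hTK hs)))
end

section
/- Let E be a real inner product space, let K̄ > 0 and K_π > 0 be constants, and set s₁ := π/(√K̄ + π·K_π). Let Y : [0, s₁] → E be twice continuously differentiable with Y(0) = 0, Y'(0) ≠ 0, and ⟨Y(s), Y''(s)⟩ ≥ −(K̄/(1 − K_π·s)²)·‖Y(s)‖² for all s ∈ [0, s₁]. Then Y(s) ≠ 0 for all s ∈ (0, s₁). -/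
open scoped RealInnerProductSpace

/-- If `g` solves the Riccati inequality `g' ≤ -g² - κ` along `[0, c]` and `⟪Y, Z'⟫ ≥ -κ ‖Y‖²` with
`Y' = Z`, then `Y` cannot vanish at both endpoints unless its initial velocity vanishes. -/
theorem velocity_eq_zero_of_riccati {E : Type*} [NormedAddCommGroup E] [InnerProductSpace ℝ E]
    {c κ : ℝ} (hc : 0 < c) {Y Z W : ℝ → E} {g g' : ℝ → ℝ}
    (hY : ∀ s ∈ Set.Icc 0 c, HasDerivWithinAt Y (Z s) (Set.Icc 0 c) s)
    (hZ : ∀ s ∈ Set.Icc 0 c, HasDerivWithinAt Z (W s) (Set.Icc 0 c) s)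
    (hg : ∀ s ∈ Set.Icc 0 c, HasDerivWithinAt g (g' s) (Set.Icc 0 c) s)
    (hg' : ∀ s ∈ Set.Icc 0 c, g' s ≤ -g s ^ 2 - κ)
    (hW : ∀ s ∈ Set.Icc 0 c, -κ * ‖Y s‖ ^ 2 ≤ ⟪Y s, W s⟫)
    (h0 : Y 0 = 0) (h1 : Y c = 0) : Z 0 = 0 := by
  set h : ℝ → ℝ := fun s => ⟪Y s, Z s⟫ - g s * ⟪Y s, Y s⟫ with hh
  set h' : ℝ → ℝ := fun s => (⟪Y s, W s⟫ + ⟪Z s, Z s⟫) -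
    (g' s * ⟪Y s, Y s⟫ + g s * (⟪Y s, Z s⟫ + ⟪Z s, Y s⟫)) with hh'
  have hd : ∀ s ∈ Set.Icc 0 c, HasDerivWithinAt h (h' s) (Set.Icc 0 c) s := fun s hs =>
    ((hY s hs).inner ℝ (hZ s hs)).sub ((hg s hs).mul ((hY s hs).inner ℝ (hY s hs)))
  have hlow : ∀ s ∈ Set.Icc 0 c, ‖Z s - g s • Y s‖ ^ 2 ≤ h' s := by
    intro s hs
    have e := norm_sub_sq_real (Z s) (g s • Y s)
    rw [inner_smul_right, norm_smul, mul_pow, Real.norm_eq_abs, sq_abs] at e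
    rw [e]
    simp only [hh', real_inner_self_eq_norm_sq, real_inner_comm (Z s) (Y s)]
    nlinarith [hW s hs, mul_le_mul_of_nonneg_right (hg' s hs) (sq_nonneg ‖Y s‖)]
  have hmono : MonotoneOn h (Set.Icc 0 c) :=
    monotoneOn_of_hasDerivWithinAt_nonneg (convex_Icc 0 c)
      (fun s hs => (hd s hs).continuousWithinAt)
      (fun s hs => (hd s (interior_subset hs)).mono interior_subset)
      (fun s hs => (sq_nonneg _).trans (hlow s (interior_subset hs)))
  have m0 : (0 : ℝ) ∈ Set.Icc 0 c := ⟨le_rfl, hc.le⟩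
  have m1 : c ∈ Set.Icc 0 c := ⟨hc.le, le_rfl⟩
  have hzero : ∀ s ∈ Set.Icc 0 c, h s = 0 := by
    intro s hs
    have a := hmono m0 hs hs.1
    have b := hmono hs m1 hs.2
    simp only [hh, h0, h1, inner_zero_left, mul_zero, sub_zero] at a b
    exact le_antisymm b a
  have hd0 : h' 0 = 0 :=
    (uniqueDiffOn_Icc hc 0 m0).eq_deriv _ (hd 0 m0)
      ((hasDerivWithinAt_const (0 : ℝ) (Set.Icc 0 c) (0 : ℝ)).congr hzero (hzero 0 m0))
  have := hlow 0 m0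
  rw [hd0, h0, smul_zero, sub_zero] at this
  simpa using le_antisymm this (sq_nonneg _)

theorem no_conjugate_point_before_s1 {E : Type*} [NormedAddCommGroup E]
    [InnerProductSpace ℝ E] (Kbar Kpi : ℝ) (hK : 0 < Kbar) (hKpi : 0 < Kpi)
    (s₁ : ℝ) (hs₁ : s₁ = Real.pi / (Real.sqrt Kbar + Real.pi * Kpi)) (Y : ℝ → E)
    (hY : ContDiffOn ℝ 2 Y (Set.Icc 0 s₁))
    (h0 : Y 0 = 0) (h0' : derivWithin Y (Set.Icc 0 s₁) 0 ≠ 0)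
    (hJacobi : ∀ s ∈ Set.Icc 0 s₁,
      ⟪Y s, derivWithin (derivWithin Y (Set.Icc 0 s₁)) (Set.Icc 0 s₁) s⟫ ≥
        -(Kbar / (1 - Kpi * s) ^ 2) * ‖Y s‖ ^ 2) :
    ∀ s ∈ Set.Ioo 0 s₁, Y s ≠ 0 := by
  rintro c ⟨hc0, hc1⟩ hYc
  have hpi := Real.pi_pos
  have hsq : 0 < Real.sqrt Kbar := Real.sqrt_pos.2 hK
  have hs0 : 0 < s₁ := hc0.trans hc1
  have hfix : Real.sqrt Kbar * s₁ = Real.pi * (1 - Kpi * s₁) := by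
    rw [hs₁]; field_simp; ring
  have hsub : Set.Icc 0 c ⊆ Set.Icc 0 s₁ := Set.Icc_subset_Icc_right hc1.le
  have hu : UniqueDiffOn ℝ (Set.Icc 0 s₁) := uniqueDiffOn_Icc hs0
  have hdY : DifferentiableOn ℝ Y (Set.Icc 0 s₁) := hY.differentiableOn (by norm_num)
  have hdZ : DifferentiableOn ℝ (derivWithin Y (Set.Icc 0 s₁)) (Set.Icc 0 s₁) :=
    (hY.derivWithin hu (m := 1) (by norm_num)).differentiableOn (by norm_num)
  set M := Real.pi / s₁ with hM
  have hMpos : 0 < M := by positivity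
  have hMs : M * s₁ = Real.pi := by rw [hM]; field_simp
  have hcos : ∀ s ∈ Set.Icc 0 c, Real.cos (M * (s - c / 2)) ≠ 0 := by
    intro s hs
    have hMc : M * c < Real.pi := hMs ▸ mul_lt_mul_of_pos_left hc1 hMpos
    refine (Real.cos_pos_of_mem_Ioo ⟨?_, ?_⟩).ne'
    · nlinarith [mul_nonneg hMpos.le hs.1]
    · nlinarith [mul_le_mul_of_nonneg_left hs.2 hMpos.le]
  have hcurv : ∀ s ∈ Set.Icc 0 c, Kbar / (1 - Kpi * s) ^ 2 ≤ M ^ 2 := by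
    intro s hs
    have hsqM : Real.sqrt Kbar = M * (1 - Kpi * s₁) := by
      rw [hM, div_mul_eq_mul_div, ← hfix]; field_simp
    have hpos : 0 < 1 - Kpi * s₁ := by
      by_contra! hn
      nlinarith [mul_pos hsq hs0]
    have hle : 1 - Kpi * s₁ ≤ 1 - Kpi * s := by nlinarith [(hsub hs).2]
    rw [div_le_iff₀ (pow_pos (hpos.trans_le hle) 2), ← Real.sq_sqrt hK.le, hsqM, mul_pow]
    gcongr
  refine h0' (velocity_eq_zero_of_riccati (κ := M ^ 2) hc0
    (g := fun s => -(M * Real.tan (M * (s - c / 2))))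
    (g' := fun s => -(M * (1 / Real.cos (M * (s - c / 2)) ^ 2 * (M * 1))))
    (fun s hs => (hdY s (hsub hs)).hasDerivWithinAt.mono hsub)
    (fun s hs => (hdZ s (hsub hs)).hasDerivWithinAt.mono hsub) ?_ ?_ ?_ h0 hYc)
  · intro s hs
    have hlin : HasDerivAt (fun s : ℝ => M * (s - c / 2)) (M * 1) s :=
      ((hasDerivAt_id s).sub_const (c / 2)).const_mul M
    exact (((Real.hasDerivAt_tan (hcos s hs)).comp s hlin).const_mul M).neg.hasDerivWithinAt
  · intro s hs
    have hC := hcos s hs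
    simp only [one_div, ← Real.inv_one_add_tan_sq hC, inv_inv]
    exact le_of_eq (by ring)
  · intro s hs
    refine le_trans ?_ (hJacobi s (hsub hs))
    exact mul_le_mul_of_nonneg_right (neg_le_neg (hcurv s hs)) (sq_nonneg _)
end

section
/- Let t₀ < 0, K̄ₙ > 0, and K_π > 0. Let n : [t₀, 0] → ℝ satisfy 0 < n(t) ≤ K̄ₙ for all t, and let s : [t₀, 0] → ℝ be differentiable with s'(t) < 0 for all t, s(0) = 0, and s'(0) = −n(0). Suppose the function h(t) := log(−s'(t)/n(t)) is differentiable with |h'(t)| ≤ K_π·n(t) for all t ∈ [t₀, 0]. Then for every t ∈ [t₀, 0]: 0 ≤ s(t) ≤ (1/K_π)·(e^{K̄ₙ K_π |t|} − 1). Moreover, if instead K_π = 0 (so that h is constant), then s(t) ≤ K̄ₙ·|t|. -/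
/-- On an interval, a function whose derivative dominates that of another one, and which agrees
with it at the right endpoint, lies below it. -/
theorem le_of_hasDerivWithinAt_le_of_eq_right {f f' g g' : ℝ → ℝ} {a b : ℝ}
    (hf : ∀ x ∈ Set.Icc a b, HasDerivWithinAt f (f' x) (Set.Icc a b) x)
    (hg : ∀ x ∈ Set.Icc a b, HasDerivWithinAt g (g' x) (Set.Icc a b) x)
    (hle : ∀ x ∈ Set.Icc a b, g' x ≤ f' x) (hb : f b = g b) :
    ∀ x ∈ Set.Icc a b, f x ≤ g x := by
  intro x hx
  have hfg : ∀ y ∈ Set.Icc a b,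
      HasDerivWithinAt (fun u => f u - g u) (f' y - g' y) (Set.Icc a b) y :=
    fun y hy => (hf y hy).sub (hg y hy)
  have hmono : MonotoneOn (fun u => f u - g u) (Set.Icc a b) :=
    monotoneOn_of_hasDerivWithinAt_nonneg (convex_Icc a b)
      (fun y hy => (hfg y hy).continuousWithinAt)
      (fun y hy => (hfg y (interior_subset hy)).mono interior_subset)
      (fun y hy => sub_nonneg.2 (hle y (interior_subset hy)))
  have h := hmono hx (Set.right_mem_Icc.2 (hx.1.trans hx.2)) hx.2
  simp only [hb, sub_self] at h
  linarith

theorem affine_parameter_bounds (t₀ Kn Kpi : ℝ) (ht₀ : t₀ < 0) (hKn : 0 < Kn)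
    (hKpi : 0 ≤ Kpi) (n s : ℝ → ℝ)
    (hn : ∀ t ∈ Set.Icc t₀ 0, 0 < n t ∧ n t ≤ Kn)
    (hs : ∀ t ∈ Set.Icc t₀ 0, DifferentiableWithinAt ℝ s (Set.Icc t₀ 0) t)
    (hs' : ∀ t ∈ Set.Icc t₀ 0, derivWithin s (Set.Icc t₀ 0) t < 0)
    (hs0 : s 0 = 0)
    (hnorm : derivWithin s (Set.Icc t₀ 0) 0 = -n 0)
    (hh : ∀ t ∈ Set.Icc t₀ 0,
      DifferentiableWithinAt ℝ
        (fun u => Real.log (-(derivWithin s (Set.Icc t₀ 0) u) / n u)) (Set.Icc t₀ 0) t)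
    (hh' : ∀ t ∈ Set.Icc t₀ 0,
      |derivWithin (fun u => Real.log (-(derivWithin s (Set.Icc t₀ 0) u) / n u))
          (Set.Icc t₀ 0) t| ≤ Kpi * n t) :
    (0 < Kpi → ∀ t ∈ Set.Icc t₀ 0,
      0 ≤ s t ∧ s t ≤ (1 / Kpi) * (Real.exp (Kn * Kpi * |t|) - 1)) ∧
    (Kpi = 0 → ∀ t ∈ Set.Icc t₀ 0, s t ≤ Kn * |t|) := by
  have hsd : ∀ t ∈ Set.Icc t₀ 0,
      HasDerivWithinAt s (derivWithin s (Set.Icc t₀ 0) t) (Set.Icc t₀ 0) t :=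
    fun t ht => (hs t ht).hasDerivWithinAt
  have h0 : (0 : ℝ) ∈ Set.Icc t₀ 0 := Set.right_mem_Icc.2 ht₀.le
  have hspeed : ∀ t ∈ Set.Icc t₀ 0,
      -(Kn * Real.exp (Kn * Kpi * -t)) ≤ derivWithin s (Set.Icc t₀ 0) t := by
    intro t ht
    obtain ⟨hnt, hnK⟩ := hn t ht
    have hlog := (convex_Icc t₀ 0).norm_image_sub_le_of_norm_derivWithin_le
      (C := Kn * Kpi) hh (fun u hu => (hh' u hu).trans (by
        rw [mul_comm Kn]
        exact mul_le_mul_of_nonneg_left (hn u hu).2 hKpi)) h0 ht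
    rw [hnorm, neg_neg, div_self (hn 0 h0).1.ne', Real.log_one, sub_zero, sub_zero,
      Real.norm_eq_abs, Real.norm_eq_abs, abs_of_nonpos ht.2] at hlog
    have hquot := (Real.log_le_iff_le_exp (div_pos (neg_pos.2 (hs' t ht)) hnt)).1
      ((le_abs_self _).trans hlog)
    rw [div_le_iff₀ hnt] at hquot
    have := mul_le_mul_of_nonneg_left hnK (Real.exp_pos (Kn * Kpi * -t)).le
    linarith
  refine ⟨fun hpos t ht => ⟨?_, ?_⟩, fun hzero t ht => ?_⟩
  · have hanti : AntitoneOn s (Set.Icc t₀ 0) :=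
      antitoneOn_of_hasDerivWithinAt_nonpos (convex_Icc t₀ 0)
        (fun u hu => (hs u hu).continuousWithinAt)
        (fun u hu => (hsd u (interior_subset hu)).mono interior_subset)
        (fun u hu => (hs' u (interior_subset hu)).le)
    exact hs0.symm.le.trans (hanti ht h0 ht.2)
  · rw [abs_of_nonpos ht.2]
    refine le_of_hasDerivWithinAt_le_of_eq_right
      (g := fun u => (1 / Kpi) * (Real.exp (Kn * Kpi * -u) - 1)) hsd
      (fun u _ => ?_) hspeed (by simp [hs0]) t ht
    have hd := (((((hasDerivAt_id u).neg).const_mul (Kn * Kpi)).exp.sub_const 1).const_mul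
      (1 / Kpi)).hasDerivWithinAt (s := Set.Icc t₀ 0)
    refine hd.congr_deriv ?_
    simp only [Pi.neg_apply, id]
    field_simp
  · rw [abs_of_nonpos ht.2]
    refine le_of_hasDerivWithinAt_le_of_eq_right (g := fun u => Kn * -u)
      (g' := fun _ => -Kn) hsd (fun u _ => ?_) (fun u hu => ?_) (by simp [hs0]) t ht
    · simpa using (((hasDerivAt_id u).neg).const_mul Kn).hasDerivWithinAt (s := Set.Icc t₀ 0)
    · simpa [hzero] using hspeed u hu
end

section
/- Let E be a real inner product space, p ∈ E, and let x be a map into E that is twice differentiable on an open interval around a point s, with x(s) ≠ p. Then the radial function r(u) := ‖x(u) − p‖ is twice differentiable at s and satisfies r'(s) = ⟨u_r(s), x'(s)⟩ and r''(s) ≥ ⟨u_r(s), x''(s)⟩, where u_r(s) := (x(s) − p)/‖x(s) − p‖ is the unit radial vector. -/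
open scoped RealInnerProductSpace

theorem HasDerivAt.norm_of_ne_zero_s14 {E : Type*} [NormedAddCommGroup E] [InnerProductSpace ℝ E]
    {f : ℝ → E} {f' : E} {t : ℝ} (hf : HasDerivAt f f' t) (h0 : f t ≠ 0) :
    HasDerivAt (fun u => ‖f u‖) (⟪f t, f'⟫ / ‖f t‖) t := by
  have h := hf.norm_sq.sqrt (pow_ne_zero 2 (norm_ne_zero_iff.mpr h0))
  simpa only [Real.sqrt_sq (norm_nonneg _), mul_div_mul_left _ _ (two_ne_zero' ℝ)] using h

/-- The second derivative of `‖f‖` dominates the radial component of the second derivative `c`,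
by Cauchy–Schwarz. Here `a = f t` and `b` is the first derivative. -/
theorem inner_div_norm_le_second_variation {E : Type*} [NormedAddCommGroup E]
    [InnerProductSpace ℝ E] {a : E} (b c : E) (ha : a ≠ 0) :
    ⟪a, c⟫ / ‖a‖ ≤ ((⟪a, c⟫ + ⟪b, b⟫) * ‖a‖ - ⟪a, b⟫ * (⟪a, b⟫ / ‖a‖)) / ‖a‖ ^ 2 := by
  have hpos : 0 < ‖a‖ := norm_pos_iff.mpr ha
  have hcs : ⟪a, b⟫ * ⟪a, b⟫ ≤ ‖a‖ ^ 2 * ⟪b, b⟫ := by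
    simpa only [real_inner_self_eq_norm_sq] using real_inner_mul_inner_self_le a b
  have hdiff : ((⟪a, c⟫ + ⟪b, b⟫) * ‖a‖ - ⟪a, b⟫ * (⟪a, b⟫ / ‖a‖)) / ‖a‖ ^ 2 - ⟪a, c⟫ / ‖a‖ =
      (‖a‖ ^ 2 * ⟪b, b⟫ - ⟪a, b⟫ * ⟪a, b⟫) / ‖a‖ ^ 3 := by
    field_simp
    ring
  rw [← sub_nonneg, hdiff]
  exact div_nonneg (sub_nonneg.mpr hcs) (by positivity)

theorem radial_function_variation {E : Type*} [NormedAddCommGroup E]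
    [InnerProductSpace ℝ E] (p : E) (s ε : ℝ) (hε : 0 < ε) (x : ℝ → E)
    (hx : ∀ u ∈ Set.Ioo (s - ε) (s + ε), DifferentiableAt ℝ x u)
    (hx' : ∀ u ∈ Set.Ioo (s - ε) (s + ε), DifferentiableAt ℝ (deriv x) u)
    (hne : x s ≠ p) :
    DifferentiableAt ℝ (fun u => ‖x u - p‖) s ∧
    DifferentiableAt ℝ (deriv fun u => ‖x u - p‖) s ∧
    deriv (fun u => ‖x u - p‖) s = ⟪(‖x s - p‖)⁻¹ • (x s - p), deriv x s⟫ ∧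
    deriv (deriv fun u => ‖x u - p‖) s ≥
      ⟪(‖x s - p‖)⁻¹ • (x s - p), deriv (deriv x) s⟫ := by
  have hs : s ∈ Set.Ioo (s - ε) (s + ε) := by constructor <;> linarith
  have h0 : x s - p ≠ 0 := sub_ne_zero.mpr hne
  have hfirst : ∀ u ∈ Set.Ioo (s - ε) (s + ε), x u ≠ p →
      HasDerivAt (fun u => ‖x u - p‖) (⟪x u - p, deriv x u⟫ / ‖x u - p‖) u := fun u hu hup =>
    ((hx u hu).hasDerivAt.sub_const p).norm_of_ne_zero_s14 (sub_ne_zero.mpr hup)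
  have heq : (deriv fun u => ‖x u - p‖) =ᶠ[nhds s]
      fun u => ⟪x u - p, deriv x u⟫ / ‖x u - p‖ := by
    filter_upwards [isOpen_Ioo.mem_nhds hs, (hx s hs).continuousAt.eventually_ne hne]
      with u hu hup using (hfirst u hu hup).deriv
  have hsecond := ((((hx s hs).hasDerivAt.sub_const p).inner ℝ (hx' s hs).hasDerivAt).fun_div
    (hfirst s hs hne) (norm_ne_zero_iff.mpr h0)).congr_of_eventuallyEq heq
  refine ⟨(hfirst s hs hne).differentiableAt, hsecond.differentiableAt, ?_, ?_⟩
  · rw [(hfirst s hs hne).deriv, real_inner_smul_left, div_eq_inv_mul]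
  · rw [hsecond.deriv, real_inner_smul_left, ← div_eq_inv_mul]
    exact inner_div_norm_le_second_variation _ _ h0
end

section
/- Let E be a real inner product space, p ∈ E, a > 0, and K < 0. Let x : [0, a] → E be twice continuously differentiable with x(0) = p, ‖x'(0)‖ = 1, and suppose that ⟨(x(s) − p)/‖x(s) − p‖, x''(s)⟩ ≥ K for every s ∈ (0, a] with x(s) ≠ p. Set s* := min(a, −1/K). Then for every s ∈ (0, s*): x(s) ≠ p and the derivative of r(u) := ‖x(u) − p‖ at s satisfies r'(s) ≥ 1 + K·s > 0; in particular, r is strictly increasing on [0, s*). -/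
open scoped RealInnerProductSpace
open Set Filter Topology

/-- The derivative of the norm of a curve away from its zeros. -/
theorem hasDerivAt_norm_curve {E : Type*} [NormedAddCommGroup E] [InnerProductSpace ℝ E]
    {y : ℝ → E} {v : E} {s : ℝ} (hy : HasDerivAt y v s) (hne : y s ≠ 0) :
    HasDerivAt (fun u => ‖y u‖) (⟪y s, v⟫ / ‖y s‖) s := by
  have hpos : 0 < ‖y s‖ := norm_pos_iff.2 hne
  have h := (hy.norm_sq.sqrt (by positivity : ‖y s‖ ^ 2 ≠ 0))
  simp only [Real.sqrt_sq (norm_nonneg _)] at h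
  convert h using 1
  field_simp

/-- The derivative of the radial speed of a curve away from its zeros is at least the radial
component of the acceleration. -/
theorem exists_hasDerivAt_radial_speed {E : Type*} [NormedAddCommGroup E]
    [InnerProductSpace ℝ E] {y v : ℝ → E} {w : E} {s : ℝ} (hy : HasDerivAt y (v s) s)
    (hv : HasDerivAt v w s) (hne : y s ≠ 0) :
    ∃ d, HasDerivAt (fun u => ⟪y u, v u⟫ / ‖y u‖) d s ∧ ⟪(‖y s‖)⁻¹ • y s, w⟫ ≤ d := by
  have hpos : 0 < ‖y s‖ := norm_pos_iff.2 hne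
  refine ⟨_, (hy.inner ℝ hv).div (hasDerivAt_norm_curve hy hne) hpos.ne', ?_⟩
  have hcs : ⟪y s, v s⟫ * ⟪y s, v s⟫ ≤ ‖y s‖ ^ 2 * ⟪v s, v s⟫ := by
    simpa [real_inner_self_eq_norm_sq] using real_inner_mul_inner_self_le (y s) (v s)
  rw [real_inner_smul_left, le_div_iff₀ (by positivity)]
  have e1 : (‖y s‖)⁻¹ * ⟪y s, w⟫ * ‖y s‖ ^ 2 = ⟪y s, w⟫ * ‖y s‖ := by field_simp
  have e2 : ⟪y s, v s⟫ * (⟪y s, v s⟫ / ‖y s‖) ≤ ⟪v s, v s⟫ * ‖y s‖ := by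
    rw [← mul_div_assoc, div_le_iff₀ hpos]
    linarith
  rw [e1]
  linarith

/-- The radial speed of a curve leaving the origin tends to its initial speed. -/
theorem tendsto_radial_speed {E : Type*} [NormedAddCommGroup E] [InnerProductSpace ℝ E]
    {y v : ℝ → E} (h0 : y 0 = 0) (hy : HasDerivWithinAt y (v 0) (Ioi 0) 0)
    (hv : ContinuousWithinAt v (Ioi 0) 0) (hv0 : v 0 ≠ 0) :
    Tendsto (fun u => ⟪y u, v u⟫ / ‖y u‖) (𝓝[>] 0) (𝓝 ‖v 0‖) := by
  have hslope : Tendsto (fun u : ℝ => u⁻¹ • y u) (𝓝[>] 0) (𝓝 (v 0)) := by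
    simpa [slope_fun_def, h0] using
      (hasDerivWithinAt_iff_tendsto_slope' (by simp : (0 : ℝ) ∉ Ioi 0)).1 hy
  have hlim := (hslope.inner (𝕜 := ℝ) hv.tendsto).div hslope.norm (norm_ne_zero_iff.2 hv0)
  have hval : ⟪v 0, v 0⟫ / ‖v 0‖ = ‖v 0‖ := by
    rw [real_inner_self_eq_norm_mul_norm, mul_self_div_self]
  rw [hval] at hlim
  refine hlim.congr' ?_
  filter_upwards [self_mem_nhdsWithin] with u hu
  have hu : 0 < u := hu
  rw [Pi.div_apply, real_inner_smul_left, norm_smul, Real.norm_of_nonneg (inv_pos.2 hu).le,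
    mul_div_mul_left _ _ (inv_pos.2 hu).ne']

/-- A lower bound on the radial acceleration of a curve leaving the origin at unit speed bounds
its radial speed from below as long as the curve does not return to the origin. -/
theorem radial_speed_ge {E : Type*} [NormedAddCommGroup E] [InnerProductSpace ℝ E]
    {y v w : ℝ → E} {K t : ℝ} (h0 : y 0 = 0) (hy0 : HasDerivWithinAt y (v 0) (Ioi 0) 0)
    (hv0 : ContinuousWithinAt v (Ioi 0) 0) (hv1 : ‖v 0‖ = 1)
    (hy : ∀ s ∈ Ioo 0 t, HasDerivAt y (v s) s) (hv : ∀ s ∈ Ioo 0 t, HasDerivAt v (w s) s)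
    (hne : ∀ s ∈ Ioo 0 t, y s ≠ 0) (hK : ∀ s ∈ Ioo 0 t, K ≤ ⟪(‖y s‖)⁻¹ • y s, w s⟫)
    {s : ℝ} (hs : s ∈ Ioo 0 t) : 1 + K * s ≤ ⟪y s, v s⟫ / ‖y s‖ := by
  choose! d hd hdw using fun u hu =>
    exists_hasDerivAt_radial_speed (hy u hu) (hv u hu) (hne u hu)
  have hderiv : ∀ u ∈ Ioo 0 t,
      HasDerivAt (fun u => ⟪y u, v u⟫ / ‖y u‖ - K * u) (d u - K) u := fun u hu =>
    (hd u hu).sub (hasDerivAt_const_mul K)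
  have hmono : MonotoneOn (fun u => ⟪y u, v u⟫ / ‖y u‖ - K * u) (Ioo 0 t) := by
    refine monotoneOn_of_deriv_nonneg (convex_Ioo 0 t)
      (fun u hu => (hderiv u hu).continuousAt.continuousWithinAt) ?_ ?_
    · rw [interior_Ioo]
      exact fun u hu => (hderiv u hu).differentiableAt.differentiableWithinAt
    · rw [interior_Ioo]
      intro u hu
      rw [(hderiv u hu).deriv]
      linarith [hK u hu, hdw u hu]
  have hlin : Tendsto (fun u : ℝ => K * u) (𝓝[>] 0) (𝓝 0) := by
    have : ContinuousWithinAt (fun u : ℝ => K * u) (Ioi 0) 0 := by fun_prop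
    simpa using this.tendsto
  have hlim := (tendsto_radial_speed h0 hy0 hv0 (norm_ne_zero_iff.1 (by simp [hv1]))).sub hlin
  rw [hv1, sub_zero] at hlim
  have hle : 1 ≤ ⟪y s, v s⟫ / ‖y s‖ - K * s := by
    refine le_of_tendsto hlim ?_
    filter_upwards [Ioo_mem_nhdsGT hs.1] with u hu
    exact hmono ⟨hu.1, hu.2.trans hs.2⟩ hs hu.2.le
  linarith

/-- A continuous function on an interval whose derivative is positive in the interior is strictly
increasing. -/
theorem strictMonoOn_of_hasDerivAt_pos {D : Set ℝ} (hD : Convex ℝ D) {f f' : ℝ → ℝ}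
    (hf : ContinuousOn f D) (hf' : ∀ u ∈ interior D, HasDerivAt f (f' u) u)
    (hpos : ∀ u ∈ interior D, 0 < f' u) : StrictMonoOn f D :=
  strictMonoOn_of_deriv_pos hD hf fun u hu => (hf' u hu).deriv ▸ hpos u hu

/-- A curve leaving the origin at unit speed whose radial acceleration is at least `K` does not
return to the origin while `1 + K * s` is positive. -/
theorem ne_zero_of_radial_acceleration_ge {E : Type*} [NormedAddCommGroup E]
    [InnerProductSpace ℝ E] {y v w : ℝ → E} {K b : ℝ} (h0 : y 0 = 0)
    (hy0 : HasDerivWithinAt y (v 0) (Ioi 0) 0)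
    (hv0 : ContinuousWithinAt v (Ioi 0) 0) (hv1 : ‖v 0‖ = 1) (hyc : ContinuousOn y (Ico 0 b))
    (hy : ∀ s ∈ Ioo 0 b, HasDerivAt y (v s) s) (hv : ∀ s ∈ Ioo 0 b, HasDerivAt v (w s) s)
    (hK : ∀ s ∈ Ioo 0 b, y s ≠ 0 → K ≤ ⟪(‖y s‖)⁻¹ • y s, w s⟫)
    (hpos : ∀ s ∈ Ioo 0 b, 0 < 1 + K * s) {s : ℝ} (hs : s ∈ Ioo 0 b) : y s ≠ 0 := by
  intro hys
  have hev : ∀ᶠ u in 𝓝[>] 0, y u ≠ 0 := by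
    have := hy0.eventually_ne (c := 0) (norm_ne_zero_iff.1 (by simp [hv1]))
    rwa [sdiff_singleton_eq_self (by simp)] at this
  obtain ⟨ε, hε, hεne⟩ := mem_nhdsGT_iff_exists_Ioo_subset.1 hev
  have hε : 0 < ε := hε
  have hεs : ε ≤ s := not_lt.1 fun h => hεne ⟨hs.1, h⟩ hys
  have hcomp : IsCompact (Icc (ε / 2) s ∩ y ⁻¹' {0}) := by
    refine isCompact_Icc.of_isClosed_subset ?_ inter_subset_left
    have hc : ContinuousOn y (Icc (ε / 2) s) :=
      hyc.mono fun u hu => ⟨by linarith [hu.1], hu.2.trans_lt hs.2⟩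
    exact hc.preimage_isClosed_of_isClosed isClosed_Icc isClosed_singleton
  obtain ⟨t, ⟨⟨htε, hts⟩, hyt⟩, hmin⟩ :=
    hcomp.exists_isLeast ⟨s, ⟨by linarith, le_rfl⟩, hys⟩
  have ht0 : 0 < t := by linarith
  have hne : ∀ u ∈ Ioo 0 t, y u ≠ 0 := by
    intro u hu hyu
    rcases lt_or_ge u ε with h | h
    · exact hεne ⟨hu.1, h⟩ hyu
    · exact hu.2.not_ge (hmin ⟨⟨by linarith, hu.2.le.trans hts⟩, hyu⟩)
  have hsub : Ioo 0 t ⊆ Ioo 0 b := Ioo_subset_Ioo_right (hts.trans hs.2.le)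
  have hmono : StrictMonoOn (fun u => ‖y u‖) (Icc 0 t) := by
    refine strictMonoOn_of_hasDerivAt_pos (f' := fun u => ⟪y u, v u⟫ / ‖y u‖) (convex_Icc 0 t)
      (hyc.mono (Icc_subset_Ico_right (hts.trans_lt hs.2))).norm ?_ ?_
    · rw [interior_Icc]
      exact fun u hu => hasDerivAt_norm_curve (hy u (hsub hu)) (hne u hu)
    · rw [interior_Icc]
      exact fun u hu => (hpos u (hsub hu)).trans_le <|
        radial_speed_ge h0 hy0 hv0 hv1 (fun u hu => hy u (hsub hu)) (fun u hu => hv u (hsub hu))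
          hne (fun u hu => hK u (hsub hu) (hne u hu)) hu
  have hlt := hmono (left_mem_Icc.2 ht0.le) (right_mem_Icc.2 ht0.le) ht0
  have hyt : y t = 0 := hyt
  simp [h0, hyt] at hlt

theorem radial_distance_increasing {E : Type*} [NormedAddCommGroup E]
    [InnerProductSpace ℝ E] (p : E) (a K : ℝ) (ha : 0 < a) (hK : K < 0) (x : ℝ → E)
    (hx : ContDiffOn ℝ 2 x (Set.Icc 0 a))
    (h0 : x 0 = p) (h0' : ‖derivWithin x (Set.Icc 0 a) 0‖ = 1)
    (hacc : ∀ s ∈ Set.Ioc 0 a, x s ≠ p →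
      ⟪(‖x s - p‖)⁻¹ • (x s - p),
        derivWithin (derivWithin x (Set.Icc 0 a)) (Set.Icc 0 a) s⟫ ≥ K) :
    (∀ s ∈ Set.Ioo 0 (min a (-1 / K)),
      x s ≠ p ∧
      derivWithin (fun u => ‖x u - p‖) (Set.Icc 0 a) s ≥ 1 + K * s ∧
      0 < 1 + K * s) ∧
    StrictMonoOn (fun u => ‖x u - p‖) (Set.Ico 0 (min a (-1 / K))) := by
  set b := min a (-1 / K)
  set v := derivWithin x (Icc 0 a)
  have hba : b ≤ a := min_le_left _ _
  have huniq := uniqueDiffOn_Icc ha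
  have h0mem : (0 : ℝ) ∈ Icc 0 a := left_mem_Icc.2 ha.le
  have hv : ContDiffOn ℝ 1 v (Icc 0 a) := hx.derivWithin huniq (by norm_num)
  have hnhds : ∀ s ∈ Ioo 0 b, Icc 0 a ∈ 𝓝 s := fun s hs =>
    Icc_mem_nhds hs.1 (hs.2.trans_le hba)
  have hxd : ∀ s ∈ Icc 0 a, HasDerivWithinAt (fun u => x u - p) (v s) (Icc 0 a) s :=
    fun s hs => ((hx.differentiableOn (by norm_num)) s hs).hasDerivWithinAt.sub_const p
  have hvd : ∀ s ∈ Icc 0 a, HasDerivWithinAt v (derivWithin v (Icc 0 a) s) (Icc 0 a) s :=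
    fun s hs => ((hv.differentiableOn (by norm_num)) s hs).hasDerivWithinAt
  have hright : Icc 0 a ∈ 𝓝[>] (0 : ℝ) := Icc_mem_nhdsGT ha
  have hy0 : HasDerivWithinAt (fun u => x u - p) (v 0) (Ioi 0) 0 :=
    (hxd 0 h0mem).mono_of_mem_nhdsWithin hright
  have hv0 : ContinuousWithinAt v (Ioi 0) 0 :=
    ((hvd 0 h0mem).mono_of_mem_nhdsWithin hright).continuousWithinAt
  have hyc : ContinuousOn (fun u => x u - p) (Ico 0 b) := fun s hs =>
    ((hxd s ⟨hs.1, hs.2.le.trans hba⟩).continuousWithinAt).mono fun u hu =>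
      ⟨hu.1, hu.2.le.trans hba⟩
  have hy : ∀ s ∈ Ioo 0 b, HasDerivAt (fun u => x u - p) (v s) s := fun s hs =>
    (hxd s (mem_of_mem_nhds (hnhds s hs))).hasDerivAt (hnhds s hs)
  have hv' : ∀ s ∈ Ioo 0 b, HasDerivAt v (derivWithin v (Icc 0 a) s) s := fun s hs =>
    (hvd s (mem_of_mem_nhds (hnhds s hs))).hasDerivAt (hnhds s hs)
  have hpos : ∀ s ∈ Ioo 0 b, 0 < 1 + K * s := by
    intro s hs
    have h := (lt_div_iff_of_neg hK).1 (hs.2.trans_le (min_le_right _ _))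
    linarith
  have hacc' : ∀ s ∈ Ioo 0 b, x s - p ≠ 0 →
      K ≤ ⟪(‖x s - p‖)⁻¹ • (x s - p), derivWithin v (Icc 0 a) s⟫ := fun s hs hne =>
    hacc s ⟨hs.1, hs.2.le.trans hba⟩ (sub_ne_zero.1 hne)
  have hne : ∀ s ∈ Ioo 0 b, x s - p ≠ 0 := fun s hs =>
    ne_zero_of_radial_acceleration_ge (y := fun u => x u - p) (sub_eq_zero.2 h0) hy0 hv0 h0' hyc hy hv'
      hacc' hpos hs
  have hr : ∀ s ∈ Ioo 0 b,
      HasDerivAt (fun u => ‖x u - p‖) (⟪x s - p, v s⟫ / ‖x s - p‖) s := fun s hs =>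
    hasDerivAt_norm_curve (hy s hs) (hne s hs)
  have hge : ∀ s ∈ Ioo 0 b, 1 + K * s ≤ ⟪x s - p, v s⟫ / ‖x s - p‖ := fun s hs =>
    radial_speed_ge (y := fun u => x u - p) (sub_eq_zero.2 h0) hy0 hv0 h0' hy hv' hne
      (fun u hu => hacc' u hu (hne u hu)) hs
  refine ⟨fun s hs => ⟨sub_ne_zero.1 (hne s hs), ?_, hpos s hs⟩, ?_⟩
  · rw [derivWithin_of_mem_nhds (hnhds s hs), (hr s hs).deriv]
    exact hge s hs
  · refine strictMonoOn_of_hasDerivAt_pos (f' := fun u => ⟪x u - p, v u⟫ / ‖x u - p‖)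
      (convex_Ico 0 b) hyc.norm ?_ ?_
    · rwa [interior_Ico]
    · rw [interior_Ico]
      exact fun u hu => (hpos u hu).trans_le (hge u hu)
end
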